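/- arXiv:1309.6351 — 2 statements merged into one kernel-verified Lean document; each statement's English description precedes it below -/
import Mathlib

section
/- Let I be a monomial ideal of S containing no variable and let s ≥ 1 be an integer. Assume that the ideal I^s has linear quotients with respect to the restriction of a monomial order on S to G(I^s). Then there exists a linear order ≺ on G(I) such that for any two monomials u ≺ v in G(I) with gcd(u,v) = 1 there exists a monomial w ∈ G(I) with w ≠ u, w ≠ v, u ≺ w, and supp(w) ⊆ supp(u) ∪ supp(v). -/
open MvPolynomial

/-- The monomial ideal of `MvPolynomial (Fin n) K` generated by the monomials
whose exponent vectors lie in `A`. -/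
noncomputable def mIdeal (K : Type) [Field K] {n : ℕ} (A : Set (Fin n →₀ ℕ)) :
    Ideal (MvPolynomial (Fin n) K) :=
  Ideal.span ((fun a => monomial a (1 : K)) '' A)

/-- `G` is the (unique) minimal set of monomial generators of the monomial ideal `I`:
the monomials with exponent vectors in `G` generate `I`, and `G` is an antichain with
respect to divisibility of monomials (i.e. the pointwise order on exponent vectors). -/
def IsMinGen (K : Type) [Field K] {n : ℕ} (G : Finset (Fin n →₀ ℕ))
    (I : Ideal (MvPolynomial (Fin n) K)) : Prop :=
  I = mIdeal K (↑G : Set (Fin n →₀ ℕ)) ∧ ∀ a ∈ G, ∀ b ∈ G, a ≤ b → a = b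

/-- `r` is (the strict order of) a monomial order on `K[x_1,…,x_n]`, viewed on exponent
vectors (so multiplication of monomials is addition of exponent vectors): a strict linear
order such that the monomial `1` (exponent vector `0`) is smallest and which is compatible
with multiplication. -/
def IsMonomialOrder {n : ℕ} (r : (Fin n →₀ ℕ) → (Fin n →₀ ℕ) → Prop) : Prop :=
  (∀ a b c, r a b → r b c → r a c) ∧
  (∀ a b, a ≠ b → r a b ∨ r b a) ∧
  (∀ a, ¬ r a a) ∧
  (∀ a, a ≠ 0 → r 0 a) ∧
  (∀ a b c, r a b → r (a + c) (b + c))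

/-- The ideal `J` is generated by a subset of the variables `x_1,…,x_n`. -/
def GenByVars (K : Type) [Field K] {n : ℕ} (J : Ideal (MvPolynomial (Fin n) K)) : Prop :=
  ∃ V : Set (Fin n), J = Ideal.span ((fun i => (X i : MvPolynomial (Fin n) K)) '' V)

/-- The monomial ideal with minimal monomial generators `G` has linear quotients with
respect to the linear order `r` on `G`: for every generator `u`, the colon ideal of the
ideal generated by the generators preceding `u` by `u` is generated by a subset of the
variables.  (For the `r`-smallest generator this colon ideal is the zero ideal, which is
generated by the empty subset of variables, so the condition is vacuous there.) -/
noncomputable def HasLinearQuotients (K : Type) [Field K] {n : ℕ}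
    (G : Finset (Fin n →₀ ℕ)) (r : (Fin n →₀ ℕ) → (Fin n →₀ ℕ) → Prop) : Prop :=
  ∀ u ∈ G, GenByVars K
    ((mIdeal K {v | v ∈ G ∧ r v u}).colon (Ideal.span {monomial u (1 : K)}))

open scoped Pointwise

namespace IsMonomialOrder

variable {n : ℕ} {r : (Fin n →₀ ℕ) → (Fin n →₀ ℕ) → Prop}

theorem asymm (hr : IsMonomialOrder r) {a b : Fin n →₀ ℕ} (h : r a b) : ¬ r b a :=
  fun h' => hr.2.2.1 a (hr.1 a b a h h')

theorem not_trans (hr : IsMonomialOrder r) {a b c : Fin n →₀ ℕ} (h₁ : ¬ r b a) (h₂ : ¬ r c b) :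
    ¬ r c a := by
  intro h
  by_cases hab : a = b
  · exact h₂ (hab ▸ h)
  · rcases hr.2.1 a b hab with h' | h'
    · exact h₂ (hr.1 _ _ _ h h')
    · exact h₁ h'

theorem not_add_right (hr : IsMonomialOrder r) {a b : Fin n →₀ ℕ} (h : ¬ r b a)
    (c : Fin n →₀ ℕ) : ¬ r (b + c) (a + c) := by
  by_cases hab : a = b
  · subst hab
    exact hr.2.2.1 _
  · rcases hr.2.1 a b hab with h' | h'
    · exact hr.asymm (hr.2.2.2.2 _ _ c h')
    · exact absurd h' h

theorem not_add (hr : IsMonomialOrder r) {a b c d : Fin n →₀ ℕ} (h₁ : ¬ r b a) (h₂ : ¬ r d c) :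
    ¬ r (b + d) (a + c) := by
  refine hr.not_trans (hr.not_add_right h₁ c) ?_
  rw [add_comm b d, add_comm b c]
  exact hr.not_add_right h₂ b

theorem of_le_of_ne (hr : IsMonomialOrder r) {a b : Fin n →₀ ℕ} (h : a ≤ b) (hne : a ≠ b) :
    r a b := by
  obtain ⟨c, rfl⟩ := exists_add_of_le h
  have hc : c ≠ 0 := by
    rintro rfl
    simp at hne
  simpa [add_comm] using hr.2.2.2.2 _ _ a (hr.2.2.2.1 c hc)

/-- If `v` is the smallest and `u` the second smallest among the elements of `A` supported in
`W`, then `s • v` is the smallest `s`-fold sum of elements of `A` supported in `W`, and every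
other such sum is at least `u + (s - 1) • v`. -/
theorem eq_nsmul_or_not_lt_of_mem_nsmul (hr : IsMonomialOrder r) {A : Set (Fin n →₀ ℕ)}
    {W : Finset (Fin n)} {u v : Fin n →₀ ℕ} (hvu : r v u)
    (hA : ∀ a ∈ A, a.support ⊆ W → a = v ∨ ¬ r a u) (s : ℕ) :
    ∀ x ∈ s • A, x.support ⊆ W → x = s • v ∨ ∃ t, s = t + 1 ∧ ¬ r x (u + t • v) := by
  induction s with
  | zero =>
    intro x hx _
    left
    simpa using hx
  | succ s ih =>
    intro x hx hW
    rw [succ_nsmul] at hx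
    obtain ⟨y, hy, a, ha, rfl⟩ := Set.mem_add.1 hx
    have hyW : y.support ⊆ W := (Finsupp.support_mono le_self_add).trans hW
    have haW : a.support ⊆ W := (Finsupp.support_mono le_add_self).trans hW
    rcases ih y hy hyW with rfl | ⟨t, rfl, ht⟩
    · rcases hA a ha haW with rfl | hau
      · exact Or.inl (succ_nsmul _ _).symm
      · refine Or.inr ⟨s, rfl, ?_⟩
        rw [add_comm _ a]
        exact hr.not_add_right hau _
    · refine Or.inr ⟨t + 1, rfl, ?_⟩
      have hav : ¬ r a v := by
        rcases hA a ha haW with rfl | hau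
        · exact hr.2.2.1 _
        · exact hr.not_trans (hr.asymm hvu) hau
      rw [succ_nsmul, ← add_assoc]
      exact hr.not_add ht hav

end IsMonomialOrder

theorem mIdeal_pow (K : Type) [Field K] {n : ℕ} (A : Set (Fin n →₀ ℕ)) (s : ℕ) :
    mIdeal K A ^ s = mIdeal K (s • A) := by
  induction s with
  | zero =>
    simp only [mIdeal, pow_zero, zero_nsmul, Ideal.one_eq_top]
    symm
    rw [Ideal.eq_top_iff_one]
    exact Ideal.subset_span ⟨0, rfl, rfl⟩
  | succ s ih =>
    rw [pow_succ, ih, succ_nsmul]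
    simp only [mIdeal]
    rw [Ideal.span_mul_span']
    congr 1
    ext p
    simp only [Set.mem_mul, Set.mem_add, Set.mem_image]
    constructor
    · rintro ⟨_, ⟨a, ha, rfl⟩, _, ⟨b, hb, rfl⟩, rfl⟩
      exact ⟨a + b, ⟨a, ha, b, hb, rfl⟩, by simp [monomial_mul]⟩
    · rintro ⟨_, ⟨a, ha, b, hb, rfl⟩, rfl⟩
      exact ⟨_, ⟨a, ha, rfl⟩, _, ⟨b, hb, rfl⟩, by simp [monomial_mul]⟩

theorem monomial_mem_mIdeal (K : Type) [Field K] {n : ℕ} {A : Set (Fin n →₀ ℕ)}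
    {a : Fin n →₀ ℕ} : monomial a (1 : K) ∈ mIdeal K A ↔ ∃ b ∈ A, b ≤ a := by
  classical
  simp [mIdeal, mem_ideal_span_monomial_image, support_monomial]

/-- Let `I` be a monomial ideal of `S = K[x_1,…,x_n]` containing no variable, with minimal
monomial generating set `G`, and let `s ≥ 1`.  If `I^s` has linear quotients with respect
to the restriction of a monomial order `r` on `S` to `G(I^s)`, then there is a linear
order `p` on `G(I)` such that for any `u ≺ v` in `G(I)` with `gcd(u,v) = 1` there is
`w ∈ G(I)` with `w ≠ u`, `w ≠ v`, `u ≺ w` and `supp w ⊆ supp u ∪ supp v`. -/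
theorem powers_linear_quotients_strong_support_condition
    {K : Type} [Field K] {n : ℕ}
    (I : Ideal (MvPolynomial (Fin n) K)) (G Gs : Finset (Fin n →₀ ℕ))
    (s : ℕ) (hs : 1 ≤ s)
    (hG : IsMinGen K G I) (hGs : IsMinGen K Gs (I ^ s))
    (hnovar : ∀ i : Fin n, Finsupp.single i 1 ∉ G)
    (r : (Fin n →₀ ℕ) → (Fin n →₀ ℕ) → Prop) (hr : IsMonomialOrder r)
    (hlq : HasLinearQuotients K Gs r) :
    ∃ p : (Fin n →₀ ℕ) → (Fin n →₀ ℕ) → Prop,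
      (∀ a ∈ G, ¬ p a a) ∧
      (∀ a ∈ G, ∀ b ∈ G, ∀ c ∈ G, p a b → p b c → p a c) ∧
      (∀ a ∈ G, ∀ b ∈ G, a ≠ b → p a b ∨ p b a) ∧
      (∀ u ∈ G, ∀ v ∈ G, p u v → u ⊓ v = 0 →
        ∃ w ∈ G, w ≠ u ∧ w ≠ v ∧ p u w ∧
          (w.support : Set (Fin n)) ⊆ (u.support : Set (Fin n)) ∪ (v.support : Set (Fin n))) := by
  classical
  obtain ⟨rfl, hanti⟩ := hG
  obtain ⟨hI, hGsanti⟩ := hGs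
  rw [mIdeal_pow] at hI
  refine ⟨fun a b => r b a, fun a _ => hr.2.2.1 a, fun a _ b _ c _ h₁ h₂ => hr.1 _ _ _ h₂ h₁,
    fun a _ b _ hab => (hr.2.1 a b hab).symm, ?_⟩
  intro u hu v hv hvu hgcd
  by_contra! hcon
  have hdisj : ∀ j, u j = 0 ∨ v j = 0 := fun j => by
    have h := DFunLike.congr_fun hgcd j
    simp only [Finsupp.inf_apply, Finsupp.coe_zero, Pi.zero_apply] at h
    omega
  have hA : ∀ a ∈ (G : Set (Fin n →₀ ℕ)), a.support ⊆ u.support ∪ v.support →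
      a = v ∨ ¬ r a u := by
    intro a ha haW
    by_contra! hne
    refine hcon a ha ?_ hne.1 hne.2 (by exact_mod_cast haW)
    rintro rfl
    exact hr.2.2.1 _ hne.2
  obtain ⟨t, rfl⟩ : ∃ t, s = t + 1 := ⟨s - 1, by omega⟩
  have hGs_sum : ∀ g ∈ Gs, g ∈ (t + 1) • (G : Set (Fin n →₀ ℕ)) := by
    intro g hg
    obtain ⟨b, hb, hbg⟩ := (monomial_mem_mIdeal K).1
      (hI ▸ (monomial_mem_mIdeal K).2 ⟨g, hg, le_rfl⟩)
    obtain ⟨c, hc, hcb⟩ := (monomial_mem_mIdeal K).1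
      (hI ▸ (monomial_mem_mIdeal K).2 ⟨b, hb, le_rfl⟩)
    have hcg : c = g := hGsanti c hc g hg (hcb.trans hbg)
    rwa [le_antisymm (hcg ▸ hcb) hbg]
  have hfirst : ∀ g ∈ Gs, g.support ⊆ u.support ∪ v.support → r g (u + t • v) →
      g = (t + 1) • v := by
    intro g hg hW hlt
    rcases hr.eq_nsmul_or_not_lt_of_mem_nsmul hvu hA _ g (hGs_sum g hg) hW with h | ⟨t', ht', h⟩
    · exact h
    · obtain rfl : t = t' := by omega
      exact absurd hlt h
  have hsupp : (u + t • v).support ⊆ u.support ∪ v.support :=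
    Finsupp.support_add.trans (Finset.union_subset_union_right Finsupp.support_smul)
  have hmem_nsmul : ∀ m : ℕ, m • v ∈ m • (G : Set (Fin n →₀ ℕ)) :=
    fun m => Set.nsmul_mem_nsmul hv
  have hmem : u + t • v ∈ Gs := by
    have h : u + t • v ∈ (t + 1) • (G : Set (Fin n →₀ ℕ)) := by
      rw [succ_nsmul, add_comm u]
      exact Set.add_mem_add (hmem_nsmul t) hu
    obtain ⟨g, hg, hle⟩ := (monomial_mem_mIdeal K).1
      (hI ▸ (monomial_mem_mIdeal K).2 ⟨_, h, le_rfl⟩)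
    by_cases hne : g = u + t • v
    · exact hne ▸ hg
    · have hgv := hfirst g hg ((Finsupp.support_mono hle).trans hsupp) (hr.of_le_of_ne hle hne)
      rw [hgv, succ_nsmul, add_comm u] at hle
      have huv := hanti v hv u hu (le_of_add_le_add_left hle)
      exact absurd (huv ▸ hvu) (hr.2.2.1 _)
  have hvGs : (t + 1) • v ∈ Gs := by
    obtain ⟨g, hg, hle⟩ := (monomial_mem_mIdeal K).1
      (hI ▸ (monomial_mem_mIdeal K).2 ⟨_, hmem_nsmul (t + 1), le_rfl⟩)
    have hlt : r ((t + 1) • v) (u + t • v) := by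
      rw [succ_nsmul, add_comm _ v]
      exact hr.2.2.2.2 _ _ _ hvu
    have hgW : g.support ⊆ u.support ∪ v.support :=
      (Finsupp.support_mono hle).trans (Finsupp.support_smul.trans Finset.subset_union_right)
    have hglt : r g (u + t • v) := by
      by_cases hne : g = (t + 1) • v
      · exact hne ▸ hlt
      · exact hr.1 _ _ _ (hr.of_le_of_ne hle hne) hlt
    exact hfirst g hg hgW hglt ▸ hg
  obtain ⟨V, hV⟩ := hlq _ hmem
  have hvcolon : monomial v (1 : K) ∈
      (mIdeal K {g | g ∈ Gs ∧ r g (u + t • v)}).colon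
        (Ideal.span {monomial (u + t • v) (1 : K)}) := by
    rw [Submodule.colon_span, Submodule.mem_colon_singleton, smul_eq_mul, monomial_mul, one_mul,
      monomial_mem_mIdeal]
    refine ⟨(t + 1) • v, ⟨hvGs, ?_⟩, ?_⟩
    · rw [succ_nsmul, add_comm _ v]
      exact hr.2.2.2.2 _ _ _ hvu
    · rw [succ_nsmul, add_comm (t • v) v]
      exact add_le_add_right le_add_self v
  rw [hV, mem_ideal_span_X_image] at hvcolon
  obtain ⟨i, hiV, hvi⟩ := hvcolon v (by simp)
  have hi : (X i : MvPolynomial (Fin n) K) ∈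
      (mIdeal K {g | g ∈ Gs ∧ r g (u + t • v)}).colon
        (Ideal.span {monomial (u + t • v) (1 : K)}) :=
    hV ▸ Ideal.subset_span ⟨i, hiV, rfl⟩
  rw [Submodule.colon_span, Submodule.mem_colon_singleton, smul_eq_mul, X, monomial_mul, one_mul,
    monomial_mem_mIdeal] at hi
  obtain ⟨g, ⟨hg, hglt⟩, hgle⟩ := hi
  have hgW : g.support ⊆ u.support ∪ v.support := by
    refine (Finsupp.support_mono hgle).trans (Finsupp.support_add.trans
      (Finset.union_subset (Finsupp.support_single_subset.trans ?_) hsupp))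
    simp [hvi]
  rw [hfirst g hg hgW hglt] at hgle
  have hle : v ≤ Finsupp.single i 1 := by
    intro j
    have h := hgle j
    simp only [Finsupp.add_apply, Finsupp.smul_apply, smul_eq_mul, add_mul, one_mul] at h
    rcases hdisj j with h0 | h0 <;> omega
  refine hnovar i ((le_antisymm hle ?_) ▸ hv)
  exact Finsupp.single_le_iff.2 (Nat.one_le_iff_ne_zero.2 hvi)
end

section
/- Let G be a finite simple graph on vertex set {v_1,…,v_n} with edge ideal I(G) ⊆ S. If the complementary graph G^c has an induced 4-cycle, then I(G) does not satisfy the gcd condition. More precisely, if v_a, v_b, v_c, v_d form an induced 4-cycle of G^c, then x_a x_c and x_b x_d belong to G(I(G)), gcd(x_a x_c, x_b x_d) = 1, and no element w of G(I(G)) with w ≠ x_a x_c and w ≠ x_b x_d divides x_a x_b x_c x_d. -/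
open MvPolynomial

/-- The edge ideal of a finite simple graph on vertices `{1,…,n}`: the ideal of
`K[x_1,…,x_n]` generated by the monomials `x_i x_j` with `{i,j}` an edge of `G`. -/
noncomputable def edgeIdeal (K : Type) [Field K] {n : ℕ} (G : SimpleGraph (Fin n)) :
    Ideal (MvPolynomial (Fin n) K) :=
  Ideal.span {m | ∃ i j, G.Adj i j ∧ m = X i * X j}

/-- The exponent vectors of the monomials `x_i x_j` with `{i,j}` an edge of `G`. -/
def edgeExponents {n : ℕ} (G : SimpleGraph (Fin n)) : Set (Fin n →₀ ℕ) :=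
  {s | ∃ i j, G.Adj i j ∧ s = Finsupp.single i 1 + Finsupp.single j 1}

theorem edgeIdeal_eq_mIdeal (K : Type) [Field K] {n : ℕ} (G : SimpleGraph (Fin n)) :
    edgeIdeal K G = mIdeal K (edgeExponents G) := by
  unfold edgeIdeal mIdeal edgeExponents
  congr 1
  ext m
  constructor
  · rintro ⟨i, j, h, rfl⟩
    exact ⟨_, ⟨i, j, h, rfl⟩, by simp [X, monomial_mul]⟩
  · rintro ⟨_, ⟨i, j, h, rfl⟩, rfl⟩
    exact ⟨i, j, h, by simp [X, monomial_mul]⟩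

theorem monomial_mem_mIdeal_iff (K : Type) [Field K] {n : ℕ} (A : Set (Fin n →₀ ℕ))
    (w : Fin n →₀ ℕ) : monomial w (1 : K) ∈ mIdeal K A ↔ ∃ s ∈ A, s ≤ w := by
  classical
  simp [mIdeal, mem_ideal_span_monomial_image, support_monomial]

theorem exists_le_of_mIdeal_le {K : Type} [Field K] {n : ℕ} {A B : Set (Fin n →₀ ℕ)}
    (h : mIdeal K A ≤ mIdeal K B) {s : Fin n →₀ ℕ} (hs : s ∈ A) : ∃ t ∈ B, t ≤ s :=
  (monomial_mem_mIdeal_iff K B s).1 (h ((monomial_mem_mIdeal_iff K A s).2 ⟨s, hs, le_rfl⟩))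

theorem subset_of_mIdeal_eq {K : Type} [Field K] {n : ℕ} {A B : Set (Fin n →₀ ℕ)}
    (hA : ∀ s ∈ A, ∀ t ∈ A, s ≤ t → s = t) (h : mIdeal K A = mIdeal K B) : A ⊆ B := by
  intro s hs
  obtain ⟨t, ht, hts⟩ := exists_le_of_mIdeal_le h.le hs
  obtain ⟨r, hr, hrt⟩ := exists_le_of_mIdeal_le h.ge ht
  have hrs := hA r hr s hs (hrt.trans hts)
  have hst : s = t := le_antisymm (hrs ▸ hrt) hts
  exact hst ▸ ht

theorem edgeExponents_antichain {n : ℕ} (G : SimpleGraph (Fin n)) :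
    ∀ s ∈ edgeExponents G, ∀ t ∈ edgeExponents G, s ≤ t → s = t := by
  rintro s ⟨i, j, -, hs⟩ t ⟨k, l, -, ht⟩ hst
  obtain ⟨r, rfl⟩ := exists_add_of_le hst
  have hdeg := congrArg Finsupp.degree ht
  rw [hs] at hdeg
  have hr : r = 0 := by
    rw [← Finsupp.degree_eq_zero_iff]
    simp only [map_add, Finsupp.degree_single] at hdeg
    omega
  simp [hr]

theorem IsMinGen.coe_eq_edgeExponents {K : Type} [Field K] {n : ℕ} {G : SimpleGraph (Fin n)}
    {Gen : Finset (Fin n →₀ ℕ)} (hGen : IsMinGen K Gen (edgeIdeal K G)) :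
    (Gen : Set (Fin n →₀ ℕ)) = edgeExponents G := by
  have h := hGen.1
  rw [edgeIdeal_eq_mIdeal] at h
  exact (subset_of_mIdeal_eq hGen.2 h.symm).antisymm
    (subset_of_mIdeal_eq (edgeExponents_antichain G) h)

/-- If `v_a, v_b, v_c, v_d` form an induced 4-cycle of the complementary graph `G^c`,
then `x_a x_c` and `x_b x_d` belong to `G(I(G))`, they have gcd `1`, and no element `w`
of `G(I(G))` other than these two divides `x_a x_b x_c x_d`; in particular `I(G)` does
not satisfy the gcd condition. -/
theorem induced_four_cycle_in_complement_fails_gcd_condition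
    {K : Type} [Field K] {n : ℕ} (G : SimpleGraph (Fin n))
    (Gen : Finset (Fin n →₀ ℕ)) (hGen : IsMinGen K Gen (edgeIdeal K G))
    (a b c d : Fin n)
    (hdist : a ≠ b ∧ a ≠ c ∧ a ≠ d ∧ b ≠ c ∧ b ≠ d ∧ c ≠ d)
    (hab : ¬ G.Adj a b) (hbc : ¬ G.Adj b c) (hcd : ¬ G.Adj c d) (hda : ¬ G.Adj d a)
    (hac : G.Adj a c) (hbd : G.Adj b d) :
    (Finsupp.single a 1 + Finsupp.single c 1 : Fin n →₀ ℕ) ∈ Gen ∧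
    (Finsupp.single b 1 + Finsupp.single d 1 : Fin n →₀ ℕ) ∈ Gen ∧
    (Finsupp.single a 1 + Finsupp.single c 1 : Fin n →₀ ℕ) ⊓
      (Finsupp.single b 1 + Finsupp.single d 1) = 0 ∧
    ∀ w ∈ Gen, w ≠ Finsupp.single a 1 + Finsupp.single c 1 →
      w ≠ Finsupp.single b 1 + Finsupp.single d 1 →
      ¬ w ≤ Finsupp.single a 1 + Finsupp.single b 1 + Finsupp.single c 1 +
          Finsupp.single d 1 := by
  have hmem : ∀ w, w ∈ Gen ↔ w ∈ edgeExponents G := fun w => by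
    rw [← hGen.coe_eq_edgeExponents, Finset.mem_coe]
  obtain ⟨nab, nac, nad, nbc, nbd, ncd⟩ := hdist
  refine ⟨(hmem _).2 ⟨a, c, hac, rfl⟩, (hmem _).2 ⟨b, d, hbd, rfl⟩, ?_, ?_⟩
  · ext x
    simp only [Finsupp.inf_apply, Finsupp.add_apply, Finsupp.single_apply, Finsupp.coe_zero,
      Pi.zero_apply]
    grind
  · intro w hw hwac hwbd hle
    obtain ⟨i, j, hij, rfl⟩ := (hmem w).1 hw
    have key : ∀ x, 0 < (Finsupp.single i 1 + Finsupp.single j 1 : Fin n →₀ ℕ) x →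
        x = a ∨ x = b ∨ x = c ∨ x = d := by
      intro x hx
      have hxle := hx.trans_le (hle x)
      simp only [Finsupp.add_apply, Finsupp.single_apply] at hxle
      grind
    have hi := key i (by simp)
    have hj := key j (by simp)
    rcases hi with rfl | rfl | rfl | rfl <;> rcases hj with rfl | rfl | rfl | rfl <;>
      first
        | exact G.irrefl hij
        | exact hwac rfl
        | exact hwbd rfl
        | exact hwac (add_comm _ _)
        | exact hwbd (add_comm _ _)
        | simp_all [G.adj_comm]
end
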